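/- arXiv:2410.19114 — 5 statements merged into one kernel-verified Lean document; each statement's English description precedes it below -/
import Mathlib

section
/- Let α and β be types, let L : Finset α → β be any (deterministic) function, and let k, N ∈ ℕ with N ≥ k + 1. Let D₁ and D₂ be finite subsets of α that differ by exactly one element by addition or deletion (i.e., either D₁ = D₂ ∪ {a} for some a ∉ D₂, or D₂ = D₁ ∪ {a} for some a ∉ D₁), and suppose both |D₁| ≥ N and |D₂| ≥ N. Then for every set S ⊆ β, P(f(D₁) ∈ S) ≤ k/(N+1) + P(f(D₂) ∈ S), where for a finite set D with |D| ≥ k we define P(f(D) ∈ S) = |{E ⊆ D : |E| = k and L(E) ∈ S}| / C(|D|, k). In other words, the synthetic sample generation mechanism is (δ, ε)-differentially private with δ = k/(N+1) and ε = 0. -/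
open Classical

/-- Probability that the synthetic sample generation mechanism with parameter `k`,
run on data set `D`, produces an output in `S`:
`P(f(D) ∈ S) = |{E ⊆ D : |E| = k ∧ L E ∈ S}| / C(|D|, k)`. -/
noncomputable def mechProb {α β : Type*} (L : Finset α → β) (k : ℕ)
    (D : Finset α) (S : Set β) : ℝ :=
  ((D.powerset.filter (fun E => E.card = k ∧ L E ∈ S)).card : ℝ) / (D.card.choose k)

lemma filter_powerset_eq_filter_powersetCard {α β : Type*} (L : Finset α → β) (k : ℕ)
    (D : Finset α) (S : Set β) :
    D.powerset.filter (fun E => E.card = k ∧ L E ∈ S) =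
      (D.powersetCard k).filter (fun E => L E ∈ S) := by
  ext E
  simp [Finset.mem_powersetCard, and_assoc]

lemma mechProb_add_compl {α β : Type*} (L : Finset α → β) {k : ℕ} {D : Finset α}
    (hk : k ≤ D.card) (S : Set β) : mechProb L k D S + mechProb L k D Sᶜ = 1 := by
  have hc : (0 : ℝ) < D.card.choose k := by exact_mod_cast Nat.choose_pos hk
  unfold mechProb
  rw [← add_div, div_eq_one_iff_eq hc.ne', filter_powerset_eq_filter_powersetCard,
    filter_powerset_eq_filter_powersetCard]
  have h := Finset.card_filter_add_card_filter_not (s := D.powersetCard k) (fun E => L E ∈ S)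
  rw [Finset.card_powersetCard] at h
  simp only [Set.mem_compl_iff]
  exact_mod_cast h

lemma mechProb_le_add_of_subset {α β : Type*} (L : Finset α → β) {k : ℕ} {D D' : Finset α}
    (hk : k ≤ D.card) (hsub : D ⊆ D') (hcard : D'.card = D.card + 1) (S : Set β) :
    mechProb L k D S ≤ (k : ℝ) / (D.card + 1) + mechProb L k D' S := by
  unfold mechProb
  rw [filter_powerset_eq_filter_powersetCard, filter_powerset_eq_filter_powersetCard, hcard]
  have hle : (((D.powersetCard k).filter (fun E => L E ∈ S)).card : ℝ) ≤ D.card.choose k := by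
    exact_mod_cast (Finset.card_filter_le _ _).trans_eq (Finset.card_powersetCard k D)
  have hmono : (((D.powersetCard k).filter (fun E => L E ∈ S)).card : ℝ) ≤
      ((D'.powersetCard k).filter (fun E => L E ∈ S)).card := by
    exact_mod_cast Finset.card_le_card
      (Finset.filter_subset_filter _ (Finset.powersetCard_mono hsub))
  generalize ((D.powersetCard k).filter (fun E => L E ∈ S)).card = x at *
  generalize ((D'.powersetCard k).filter (fun E => L E ∈ S)).card = y at *
  generalize D.card = n at *
  have hc : (0 : ℝ) < n.choose k := by exact_mod_cast Nat.choose_pos hk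
  have hc' : (0 : ℝ) < (n + 1).choose k := by exact_mod_cast Nat.choose_pos (by lia)
  have hn : (0 : ℝ) < n + 1 := by positivity
  have hrec : (n.choose k : ℝ) * (n + 1) = (n + 1).choose k * (n + 1 - k) := by
    have h := Nat.choose_mul_succ_eq n k
    have h' := congrArg (Nat.cast : ℕ → ℝ) h
    push_cast [Nat.cast_sub (show k ≤ n + 1 by lia)] at h'
    exact h'
  have hx : (x : ℝ) / n.choose k ≤ 1 := (div_le_one hc).2 hle
  have hsplit : (x : ℝ) / n.choose k =
      x / n.choose k * (k / (n + 1)) + x / (n + 1).choose k := by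
    field_simp
    linear_combination -(x : ℝ) * hrec
  calc (x : ℝ) / n.choose k = x / n.choose k * (k / (n + 1)) + x / (n + 1).choose k := hsplit
    _ ≤ 1 * (k / (n + 1)) + y / (n + 1).choose k := by gcongr
    _ = _ := by rw [one_mul]

/-- The synthetic sample generation mechanism is `(δ, ε)`-differentially private with
`δ = k/(N+1)` and `ε = 0`. -/
theorem mechanism_differentially_private {α β : Type*} [DecidableEq α]
    (L : Finset α → β) (k N : ℕ) (hN : k + 1 ≤ N)
    (D₁ D₂ : Finset α)
    (hdiff : (∃ a ∉ D₂, D₁ = insert a D₂) ∨ (∃ a ∉ D₁, D₂ = insert a D₁))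
    (h1 : N ≤ D₁.card) (h2 : N ≤ D₂.card) (S : Set β) :
    mechProb L k D₁ S ≤ (k : ℝ) / (N + 1) + mechProb L k D₂ S := by
  have hbound {n : ℕ} (hn : N ≤ n) : (k : ℝ) / (n + 1) ≤ k / (N + 1) := by gcongr
  rcases hdiff with ⟨a, ha, rfl⟩ | ⟨a, ha, rfl⟩
  · have h := mechProb_le_add_of_subset L (k := k) (by lia) (Finset.subset_insert a D₂)
      (Finset.card_insert_of_notMem ha) Sᶜ
    have hD₂ := mechProb_add_compl L (k := k) (D := D₂) (by lia) S
    have hD₁ := mechProb_add_compl L (k := k) (D := insert a D₂) (by lia) S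
    linarith [hbound h2]
  · have h := mechProb_le_add_of_subset L (k := k) (by lia) (Finset.subset_insert a D₁)
      (Finset.card_insert_of_notMem ha) S
    linarith [hbound h1]
end

section
/- Let α and β be types, let L : Finset α → β be any (deterministic) function, and let k, N, w ∈ ℕ with N ≥ k + 1. Let f_w denote the mechanism that, given a finite set D with |D| ≥ N, performs w independent runs of the synthetic sample generation mechanism f on D, producing a w-tuple of outputs; i.e., f_w(D) is distributed as the w-fold independent product of f(D), so that for S ⊆ β^w, P(f_w(D) ∈ S) = Σ_{(y₁,…,y_w) ∈ S} ∏_{j=1}^w P(f(D) = y_j). Then for any two finite subsets D₁, D₂ of α that differ by exactly one element by addition or deletion, with |D₁| ≥ N and |D₂| ≥ N, and any set S ⊆ β^w, we have P(f_w(D₁) ∈ S) ≤ kw/(N+1) + P(f_w(D₂) ∈ S). That is, f_w is (δ, ε)-differentially private with δ = kw/(N+1) and ε = 0. -/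
open Classical

open scoped ENNReal

/-- Probability that the synthetic sample generation mechanism with parameter `k`,
run on data set `D`, outputs exactly `y`:
`P(f(D) = y) = |{E ⊆ D : |E| = k ∧ L E = y}| / C(|D|, k)`. -/
noncomputable def mechPoint {α β : Type*} (L : Finset α → β) (k : ℕ)
    (D : Finset α) (y : β) : ℝ≥0∞ :=
  ((D.powerset.filter (fun E => E.card = k ∧ L E = y)).card : ℝ≥0∞) / (D.card.choose k)

/-- Probability that `w` independent runs of the mechanism on `D` produce a tuple in `S`:
`P(f_w(D) ∈ S) = Σ_{(y₁,…,y_w) ∈ S} ∏_{j=1}^w P(f(D) = y_j)`. -/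
noncomputable def mechProdProb {α β : Type*} (L : Finset α → β) (k w : ℕ)
    (D : Finset α) (S : Set (Fin w → β)) : ℝ≥0∞ :=
  ∑' y : S, ∏ j : Fin w, mechPoint L k D (y.1 j)

theorem tsum_card_filter_eq {γ β : Type*} (s : Finset γ) (g : γ → β) :
    ∑' y, ((s.filter (fun x => g x = y)).card : ℝ≥0∞) = s.card := by
  have h (y : β) : ((s.filter (fun x => g x = y)).card : ℝ≥0∞)
      = ∑ x ∈ s, if y = g x then 1 else 0 := by
    simp only [Finset.card_filter, Nat.cast_sum, Nat.cast_ite, Nat.cast_one, Nat.cast_zero,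
      @eq_comm β y]
  simp_rw [h]
  rw [Summable.tsum_finsetSum (fun _ _ => ENNReal.summable)]
  simp [tsum_ite_eq]

/-- If `p ≤ q + r` pointwise with `p`, `q` of total mass at most `1`, then the product weights
satisfy `∏ p ≤ ∏ q + R`, where `R` has total mass at most `w` times that of `r`. -/
theorem exists_prod_le_prod_add {β : Type*} {p q r : β → ℝ≥0∞} {δ : ℝ≥0∞}
    (hp : ∑' y, p y ≤ 1) (hq : ∑' y, q y ≤ 1) (hr : ∑' y, r y ≤ δ)
    (hpq : ∀ y, p y ≤ q y + r y) (w : ℕ) :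
    (∑' y : Fin w → β, ∏ j, p (y j)) ≤ 1 ∧
      ∃ R : (Fin w → β) → ℝ≥0∞,
        (∀ y, ∏ j, p (y j) ≤ ∏ j, q (y j) + R y) ∧ ∑' y, R y ≤ w * δ := by
  have tsum_cons (w : ℕ) (F : (Fin (w + 1) → β) → ℝ≥0∞) :
      ∑' y, F y = ∑' (a : β) (v : Fin w → β), F (Fin.cons a v) := by
    rw [← (Fin.consEquiv (fun _ : Fin (w + 1) => β)).tsum_eq, ENNReal.tsum_prod']
    rfl
  induction w with
  | zero => exact ⟨by simp, 0, by simp, by simp⟩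
  | succ w ih =>
    obtain ⟨hprod, R, hR, hRsum⟩ := ih
    refine ⟨?_, fun y => r (y 0) * ∏ j, p (Fin.tail y j) + q (y 0) * R (Fin.tail y), ?_, ?_⟩
    · simp only [tsum_cons, Fin.prod_univ_succ, Fin.cons_zero, Fin.cons_succ,
        ENNReal.tsum_mul_left, ENNReal.tsum_mul_right]
      exact mul_le_one' hp hprod
    · intro y
      rw [Fin.prod_univ_succ, Fin.prod_univ_succ]
      calc p (y 0) * ∏ j : Fin w, p (Fin.tail y j)
          ≤ (q (y 0) + r (y 0)) * ∏ j : Fin w, p (Fin.tail y j) := by gcongr; exact hpq _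
        _ = q (y 0) * ∏ j : Fin w, p (Fin.tail y j) + r (y 0) * ∏ j : Fin w, p (Fin.tail y j) :=
          add_mul _ _ _
        _ ≤ q (y 0) * (∏ j : Fin w, q (Fin.tail y j) + R (Fin.tail y))
            + r (y 0) * ∏ j : Fin w, p (Fin.tail y j) := by gcongr; exact hR _
        _ = _ := by simp only [Fin.tail]; ring
    · simp only [tsum_cons, Fin.cons_zero, Fin.tail_cons, ENNReal.tsum_add,
        ENNReal.tsum_mul_left, ENNReal.tsum_mul_right]
      calc _ ≤ δ * 1 + 1 * (w * δ) := by gcongr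
        _ = _ := by push_cast; ring

theorem mechPoint_eq_powersetCard {α β : Type*} (L : Finset α → β) (k : ℕ) (D : Finset α)
    (y : β) :
    mechPoint L k D y
      = (((D.powersetCard k).filter (fun E => L E = y)).card : ℝ≥0∞) / (D.card.choose k) := by
  unfold mechPoint
  congr 3
  ext E
  simp [Finset.mem_powersetCard, and_assoc]

theorem tsum_mechPoint_le_one {α β : Type*} (L : Finset α → β) (k : ℕ) (D : Finset α) :
    ∑' y, mechPoint L k D y ≤ 1 := by
  simp only [mechPoint_eq_powersetCard, div_eq_mul_inv]
  rw [ENNReal.tsum_mul_right, tsum_card_filter_eq, Finset.card_powersetCard]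
  exact ENNReal.mul_inv_le_one _

theorem mechProdProb_le_add {α β : Type*} (L : Finset α → β) (k w : ℕ) {D D' : Finset α}
    {r : β → ℝ≥0∞} {δ : ℝ≥0∞} (hr : ∑' y, r y ≤ δ)
    (h : ∀ y, mechPoint L k D y ≤ mechPoint L k D' y + r y) (S : Set (Fin w → β)) :
    mechProdProb L k w D S ≤ w * δ + mechProdProb L k w D' S := by
  obtain ⟨-, R, hR, hRsum⟩ := exists_prod_le_prod_add (tsum_mechPoint_le_one L k D)
    (tsum_mechPoint_le_one L k D') hr h w
  calc mechProdProb L k w D S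
      ≤ ∑' y : S, (∏ j, mechPoint L k D' (y.1 j) + R y.1) := ENNReal.tsum_le_tsum fun y => hR y.1
    _ = mechProdProb L k w D' S + ∑' y : S, R y.1 := ENNReal.tsum_add
    _ ≤ mechProdProb L k w D' S + w * δ := by
      gcongr
      exact (ENNReal.tsum_comp_le_tsum_of_injective Subtype.val_injective R).trans hRsum
    _ = _ := add_comm _ _

theorem powersetCard_insert_filter_notMem {α : Type*} [DecidableEq α] {D : Finset α} {a : α}
    (ha : a ∉ D) (k : ℕ) :
    ((insert a D).powersetCard k).filter (fun E => a ∉ E) = D.powersetCard k := by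
  ext E
  simp only [Finset.mem_filter, Finset.mem_powersetCard]
  constructor
  · rintro ⟨⟨hE, hk⟩, haE⟩
    exact ⟨(Finset.subset_insert_iff_of_notMem haE).1 hE, hk⟩
  · rintro ⟨hE, hk⟩
    exact ⟨⟨hE.trans (Finset.subset_insert _ _), hk⟩, fun h => ha (hE h)⟩

theorem card_powersetCard_insert_filter_mem {α : Type*} [DecidableEq α] {D : Finset α} {a : α}
    (ha : a ∉ D) (k : ℕ) :
    (((insert a D).powersetCard k).filter (fun E => a ∈ E)).card + D.card.choose k
      = (D.card + 1).choose k := by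
  rw [← Finset.card_powersetCard k D, ← powersetCard_insert_filter_notMem ha,
    Finset.card_filter_add_card_filter_not, Finset.card_powersetCard,
    Finset.card_insert_of_notMem ha]

theorem mul_succ_eq_mul_choose_of_add_choose_eq {n k t : ℕ} (hk : k ≤ n)
    (ht : t + n.choose k = (n + 1).choose k) : t * (n + 1) = k * (n + 1).choose k := by
  have h := Nat.choose_mul_succ_eq n k
  obtain ⟨m, hm⟩ : ∃ m, n + 1 = k + m := ⟨n + 1 - k, by omega⟩
  rw [show n + 1 - k = m by omega] at h
  rw [← ht] at h ⊢
  nlinarith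

/-- Passing from `D` to `insert a D` mixes the old output law with the law conditioned on `a`
being selected, the latter having weight `k / (|D| + 1)`. -/
theorem mechPoint_insert_eq {α β : Type*} [DecidableEq α] (L : Finset α → β) (k : ℕ)
    {D : Finset α} {a : α} (ha : a ∉ D) (y : β) :
    mechPoint L k (insert a D) y
      = (((D.powersetCard k).filter (fun E => L E = y)).card : ℝ≥0∞) / ((D.card + 1).choose k)
        + (((((insert a D).powersetCard k).filter (fun E => a ∈ E)).filter
            (fun E => L E = y)).card : ℝ≥0∞) / ((D.card + 1).choose k) := by
  rw [mechPoint_eq_powersetCard, Finset.card_insert_of_notMem ha, ← ENNReal.add_div,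
    ← powersetCard_insert_filter_notMem ha, Finset.filter_comm, Finset.filter_comm (fun E => a ∈ E),
    ← Nat.cast_add, add_comm (Finset.card (Finset.filter _ _)), Finset.card_filter_add_card_filter_not]

theorem mechPoint_insert_le {α β : Type*} [DecidableEq α] (L : Finset α → β) {k : ℕ}
    {D : Finset α} {a : α} (ha : a ∉ D) (hk : k ≤ D.card) :
    ∃ r : β → ℝ≥0∞, ∑' y, r y ≤ (k : ℝ≥0∞) / (D.card + 1) ∧
      ∀ y, mechPoint L k (insert a D) y ≤ mechPoint L k D y + r y := by
  refine ⟨fun y => (((((insert a D).powersetCard k).filter (fun E => a ∈ E)).filter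
            (fun E => L E = y)).card : ℝ≥0∞) / ((D.card + 1).choose k), ?_, fun y => ?_⟩
  · simp only [div_eq_mul_inv]
    rw [ENNReal.tsum_mul_right, tsum_card_filter_eq, ← div_eq_mul_inv, ← div_eq_mul_inv]
    have h := mul_succ_eq_mul_choose_of_add_choose_eq hk
      (card_powersetCard_insert_filter_mem ha k)
    have hc : ((D.card + 1).choose k : ℝ≥0∞) ≠ 0 :=
      Nat.cast_ne_zero.2 (Nat.choose_pos (by omega)).ne'
    refine ENNReal.div_le_of_le_mul ?_
    rw [← ENNReal.mul_div_right_comm, ENNReal.le_div_iff_mul_le (by simp) (by simp)]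
    exact_mod_cast h.le
  · rw [mechPoint_insert_eq L k ha, mechPoint_eq_powersetCard]
    gcongr
    exact Nat.le_succ _

theorem mechPoint_le_insert {α β : Type*} [DecidableEq α] (L : Finset α → β) {k : ℕ}
    {D : Finset α} {a : α} (ha : a ∉ D) (hk : k ≤ D.card) :
    ∃ r : β → ℝ≥0∞, ∑' y, r y ≤ (k : ℝ≥0∞) / (D.card + 1) ∧
      ∀ y, mechPoint L k D y ≤ mechPoint L k (insert a D) y + r y := by
  refine ⟨fun y => k / (D.card + 1) * mechPoint L k D y, ?_, fun y => ?_⟩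
  · rw [ENNReal.tsum_mul_left]
    exact mul_le_of_le_one_right' (tsum_mechPoint_le_one L k D)
  · rw [mechPoint_insert_eq L k ha, mechPoint_eq_powersetCard]
    refine le_trans (le_of_eq ?_) (add_le_add_left le_self_add _)
    set A := ((D.powersetCard k).filter (fun E => L E = y)).card
    have hc : 0 < D.card.choose k := Nat.choose_pos hk
    have hc' : 0 < (D.card + 1).choose k := Nat.choose_pos (by omega)
    have h := Nat.choose_mul_succ_eq D.card k
    have key : (A : NNReal) / D.card.choose k = A / (D.card + 1).choose k
        + k / (D.card + 1) * (A / D.card.choose k) := by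
      obtain ⟨m, hm⟩ : ∃ m, D.card + 1 = k + m := ⟨D.card + 1 - k, by omega⟩
      rw [show D.card + 1 - k = m by omega] at h
      have hR : (D.card.choose k : NNReal) * (D.card + 1) = (D.card + 1).choose k * m := by
        exact_mod_cast h
      have hm' : (D.card : NNReal) + 1 = k + m := by exact_mod_cast hm
      have : (D.card.choose k : NNReal) ≠ 0 := by positivity
      have : ((D.card + 1).choose k : NNReal) ≠ 0 := by positivity
      have : (D.card : NNReal) + 1 ≠ 0 := by positivity
      field_simp
      rw [mul_comm _ ((D.card : NNReal) + 1)] at hR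
      linear_combination (A : NNReal) * (D.card + 1).choose k * hm' + (A : NNReal) * hR.symm
    have := congrArg (fun x : NNReal => (x : ℝ≥0∞)) key
    simpa [A, mechPoint_eq_powersetCard, ENNReal.coe_div, hc.ne', hc'.ne', -ENNReal.coe_inj]
      using this

/-- Running the synthetic sample generation mechanism `w` times is `(δ, ε)`-differentially
private with `δ = kw/(N+1)` and `ε = 0`. -/
theorem repeated_mechanism_differentially_private {α β : Type*} [DecidableEq α]
    (L : Finset α → β) (k N w : ℕ) (hN : k + 1 ≤ N)
    (D₁ D₂ : Finset α)
    (hdiff : (∃ a ∉ D₂, D₁ = insert a D₂) ∨ (∃ a ∉ D₁, D₂ = insert a D₁))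
    (h1 : N ≤ D₁.card) (h2 : N ≤ D₂.card) (S : Set (Fin w → β)) :
    mechProdProb L k w D₁ S ≤ ((k : ℝ≥0∞) * w) / ((N : ℝ≥0∞) + 1) + mechProdProb L k w D₂ S := by
  have bound {n : ℕ} (hn : N ≤ n) :
      (w : ℝ≥0∞) * ((k : ℝ≥0∞) / (n + 1)) ≤ ((k : ℝ≥0∞) * w) / ((N : ℝ≥0∞) + 1) := by
    rw [← mul_div_assoc, mul_comm]
    gcongr
  rcases hdiff with ⟨a, ha, rfl⟩ | ⟨a, ha, rfl⟩
  · obtain ⟨r, hr, h⟩ := mechPoint_insert_le L ha (k := k) (by omega)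
    exact (mechProdProb_le_add L k w hr h S).trans (add_le_add_left (bound h2) _)
  · obtain ⟨r, hr, h⟩ := mechPoint_le_insert L ha (k := k) (by omega)
    exact (mechProdProb_le_add L k w hr h S).trans (add_le_add_left (bound h1) _)
end

section
/- Let α and β be types, let L : Finset α → β be any (deterministic) function, and let k ∈ ℕ. Let D₂ be a finite subset of α, let a ∉ D₂, set D₁ = D₂ ∪ {a}, and let c = |D₁|, with k ≤ c - 1. Then for every set S ⊆ β, P(f(D₁) ∈ S) − P(f(D₂) ∈ S) ≤ k/c, where P(f(D) ∈ S) = |{E ⊆ D : |E| = k and L(E) ∈ S}| / C(|D|, k). -/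
open Classical

/-- Passing from `D` to a larger set `D'` gains at most as many `k`-subsets with a given property
as it gains `k`-subsets overall. -/
theorem card_filter_powerset_add_choose_le {α : Type*} {D D' : Finset α} (h : D ⊆ D') (k : ℕ)
    (p : Finset α → Prop) :
    (D'.powerset.filter (fun E => E.card = k ∧ p E)).card + D.card.choose k ≤
      (D.powerset.filter (fun E => E.card = k ∧ p E)).card + D'.card.choose k := by
  have hsub : D'.powerset.filter (fun E => E.card = k ∧ p E) ⊆
      D.powerset.filter (fun E => E.card = k ∧ p E) ∪
        (D'.powersetCard k \ D.powersetCard k) := by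
    intro E hE
    simp only [Finset.mem_union, Finset.mem_filter, Finset.mem_powerset, Finset.mem_sdiff,
      Finset.mem_powersetCard] at hE ⊢
    tauto
  have hle := (Finset.card_le_card hsub).trans (Finset.card_union_le _ _)
  have hcard := Finset.card_sdiff_add_card_eq_card (Finset.powersetCard_mono (n := k) h)
  rw [Finset.card_powersetCard, Finset.card_powersetCard] at hcard
  omega

/-- `P(f(D₁) ∈ S) − P(f(D₂) ∈ S) ≤ k/c` where `D₁ = D₂ ∪ {a}`, `a ∉ D₂`, `c = |D₁|`. -/
theorem mechProb_sub_le {α β : Type*} [DecidableEq α]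
    (L : Finset α → β) (k : ℕ) (D₂ : Finset α) (a : α) (ha : a ∉ D₂)
    (D₁ : Finset α) (hD₁ : D₁ = insert a D₂)
    (c : ℕ) (hc : c = D₁.card) (hk : k ≤ c - 1) (S : Set β) :
    mechProb L k D₁ S - mechProb L k D₂ S ≤ (k : ℝ) / c := by
  have hsub : D₂ ⊆ D₁ := hD₁ ▸ Finset.subset_insert a D₂
  have hcard : D₁.card = D₂.card + 1 := by rw [hD₁, Finset.card_insert_of_notMem ha]
  have key := card_filter_powerset_add_choose_le hsub k (fun E => L E ∈ S)
  have hkn : k ≤ D₂.card := by omega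
  unfold mechProb
  rw [hcard] at key
  rw [hc, hcard]
  generalize (D₁.powerset.filter (fun E => E.card = k ∧ L E ∈ S)).card = x at *
  generalize (D₂.powerset.filter (fun E => E.card = k ∧ L E ∈ S)).card = y at *
  generalize D₂.card = n at *
  have hB : (0 : ℝ) < n.choose k := by exact_mod_cast Nat.choose_pos hkn
  have hA : (0 : ℝ) < (n + 1).choose k := by
    exact_mod_cast Nat.choose_pos (hkn.trans n.le_succ)
  have hBA : (n.choose k : ℝ) ≤ (n + 1).choose k := by
    exact_mod_cast Nat.choose_le_choose k n.le_succ
  have hrec : (n.choose k : ℝ) * (n + 1) = (n + 1).choose k * (n + 1 - k) := by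
    have h := congrArg (Nat.cast (R := ℝ)) (Nat.choose_mul_succ_eq n k)
    push_cast [Nat.cast_sub (hkn.trans n.le_succ)] at h
    exact h
  have hkey : (x : ℝ) + n.choose k ≤ y + (n + 1).choose k := by exact_mod_cast key
  calc (x : ℝ) / (n + 1).choose k - y / n.choose k
      ≤ x / (n + 1).choose k - y / (n + 1).choose k := by gcongr
    _ = (x - y) / (n + 1).choose k := by rw [sub_div]
    _ ≤ ((n + 1).choose k - n.choose k) / (n + 1).choose k := by gcongr ?_ / _; linarith
    _ = k / (n + 1 : ℕ) := by
      push_cast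
      rw [div_eq_div_iff hA.ne' (by positivity)]
      linarith
end

section
/- Let α and β be types, let L : Finset α → β be any (deterministic) function, and let k ∈ ℕ. Let D₂ be a finite subset of α, let a ∉ D₂, set D₁ = D₂ ∪ {a}, and let c = |D₁|, with k ≤ c - 1. Then for every set S ⊆ β, P(f(D₂) ∈ S) − P(f(D₁) ∈ S) ≤ k/c, where P(f(D) ∈ S) = |{E ⊆ D : |E| = k and L(E) ∈ S}| / C(|D|, k). -/
open Classical

/-- `P(f(D₂) ∈ S) − P(f(D₁) ∈ S) ≤ k/c` where `D₁ = D₂ ∪ {a}`, `a ∉ D₂`, `c = |D₁|`. -/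
theorem mechProb_sub_le' {α β : Type*} [DecidableEq α]
    (L : Finset α → β) (k : ℕ) (D₂ : Finset α) (a : α) (ha : a ∉ D₂)
    (D₁ : Finset α) (hD₁ : D₁ = insert a D₂)
    (c : ℕ) (hc : c = D₁.card) (hk : k ≤ c - 1) (S : Set β) :
    mechProb L k D₂ S - mechProb L k D₁ S ≤ (k : ℝ) / c := by
  have hcard : c = D₂.card + 1 := by
    rw [hc, hD₁, Finset.card_insert_of_notMem ha]
  have hkn : k ≤ D₂.card := by omega
  have hc₁ : D₁.card = D₂.card + 1 := by omega
  have hsub : D₂ ⊆ D₁ := hD₁ ▸ Finset.subset_insert a D₂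
  have hmono : (D₂.powerset.filter (fun E => E.card = k ∧ L E ∈ S)).card ≤
      (D₁.powerset.filter (fun E => E.card = k ∧ L E ∈ S)).card :=
    Finset.card_le_card (Finset.filter_subset_filter _ (Finset.powerset_mono.2 hsub))
  have hbound : (D₂.powerset.filter (fun E => E.card = k ∧ L E ∈ S)).card ≤
      D₂.card.choose k := by
    rw [← Finset.card_powersetCard]
    refine Finset.card_le_card fun E hE => ?_
    rw [Finset.mem_filter, Finset.mem_powerset] at hE
    exact Finset.mem_powersetCard.2 ⟨hE.1, hE.2.1⟩
  unfold mechProb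
  rw [hc₁, hcard]
  generalize (D₂.powerset.filter (fun E => E.card = k ∧ L E ∈ S)).card = x at *
  generalize (D₁.powerset.filter (fun E => E.card = k ∧ L E ∈ S)).card = y at *
  generalize D₂.card = n at *
  have hp : (0 : ℝ) < n.choose k := by exact_mod_cast Nat.choose_pos hkn
  have hq : (0 : ℝ) < (n + 1).choose k := by
    exact_mod_cast Nat.choose_pos (Nat.le_succ_of_le hkn)
  have hn : (0 : ℝ) < (n : ℝ) + 1 := by positivity
  have hchoose : (n.choose k : ℝ) * (n + 1) = (n + 1).choose k * (n + 1 - k) := by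
    have h := congrArg (Nat.cast (R := ℝ)) (Nat.choose_mul_succ_eq n k)
    rw [Nat.cast_mul, Nat.cast_mul, Nat.cast_sub (Nat.le_succ_of_le hkn)] at h
    exact_mod_cast h
  have hx : (x : ℝ) / n.choose k ≤ 1 := (div_le_one hp).2 (by exact_mod_cast hbound)
  have hxy : (x : ℝ) / (n + 1).choose k ≤ y / (n + 1).choose k := by
    gcongr
  have hdiff : (x : ℝ) / n.choose k - x / (n + 1).choose k =
      x / n.choose k * (k / (n + 1)) := by
    field_simp
    linear_combination (-(x : ℝ)) * hchoose
  have hle : (x : ℝ) / n.choose k * (k / (n + 1)) ≤ k / (n + 1) :=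
    mul_le_of_le_one_left (by positivity) hx
  push_cast
  linarith
end

section
/- Let α and β be types, let L : Finset α → β be any (deterministic) function, and let k ∈ ℕ. Let D₂ be a finite subset of α, let a ∉ D₂, set D₁ = D₂ ∪ {a}, and let c = |D₁|, with k ≤ c - 1. Then for every set S ⊆ β, |P(f(D₁) ∈ S) − P(f(D₂) ∈ S)| ≤ k/c, where P(f(D) ∈ S) = |{E ⊆ D : |E| = k and L(E) ∈ S}| / C(|D|, k). -/
open Classical

theorem card_add_choose_le_card_add_choose {α β : Type*} (L : Finset α → β) (k : ℕ)
    {D₂ D₁ : Finset α} (h : D₂ ⊆ D₁) (S : Set β) :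
    (D₁.powerset.filter (fun E => E.card = k ∧ L E ∈ S)).card + D₂.card.choose k ≤
      (D₂.powerset.filter (fun E => E.card = k ∧ L E ∈ S)).card + D₁.card.choose k := by
  have hsub : D₁.powerset.filter (fun E => E.card = k ∧ L E ∈ S) ⊆
      D₂.powerset.filter (fun E => E.card = k ∧ L E ∈ S) ∪
        (D₁.powersetCard k \ D₂.powersetCard k) := by
    intro E hE
    simp only [Finset.mem_union, Finset.mem_filter, Finset.mem_powerset, Finset.mem_sdiff,
      Finset.mem_powersetCard] at hE ⊢
    tauto
  have hcard := (Finset.card_le_card hsub).trans (Finset.card_union_le _ _)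
  have hdiff := Finset.card_sdiff_add_card_eq_card (Finset.powersetCard_mono (n := k) h)
  rw [Finset.card_powersetCard, Finset.card_powersetCard] at hdiff
  omega

theorem card_filter_le_choose {α β : Type*} (L : Finset α → β) (k : ℕ)
    (D : Finset α) (S : Set β) :
    (D.powerset.filter (fun E => E.card = k ∧ L E ∈ S)).card ≤ D.card.choose k := by
  rw [← Finset.card_powersetCard]
  refine Finset.card_le_card fun E hE => ?_
  simp only [Finset.mem_filter, Finset.mem_powerset, Finset.mem_powersetCard] at hE ⊢
  exact ⟨hE.1, hE.2.1⟩

/-- If `x₂ ≤ m`, `x₂ ≤ x₁` and `x₁ - x₂ ≤ n - m`, then the ratios `x₁ / n` and `x₂ / m` differ by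
at most `1 - m / n`. -/
theorem abs_div_sub_div_le {x₁ x₂ m n : ℝ} (hm : 0 < m) (hn : 0 < n) (hmn : m ≤ n)
    (h0 : 0 ≤ x₂) (h2 : x₂ ≤ m) (h12 : x₂ ≤ x₁) (h : x₁ + m ≤ x₂ + n) :
    |x₁ / n - x₂ / m| ≤ 1 - m / n := by
  have h₁ : x₂ / n ≤ x₂ / m := by gcongr
  have h₂ : (x₁ + m) / n ≤ (x₂ + n) / n := by gcongr
  have h₃ : x₂ / n ≤ x₁ / n := by gcongr
  have h₄ : x₂ / m ≤ 1 := (div_le_one hm).2 h2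
  have h₅ : m / n ≤ 1 := (div_le_one hn).2 hmn
  have h₆ : x₂ / n = x₂ / m * (m / n) := by field_simp
  rw [add_div, add_div, div_self hn.ne'] at h₂
  rw [abs_le]
  constructor
  · nlinarith [mul_nonneg (sub_nonneg.2 h₄) (sub_nonneg.2 h₅)]
  · linarith

/-- `|P(f(D₁) ∈ S) − P(f(D₂) ∈ S)| ≤ k/c` where `D₁ = D₂ ∪ {a}`, `a ∉ D₂`, `c = |D₁|`. -/
theorem abs_mechProb_sub_le {α β : Type*} [DecidableEq α]
    (L : Finset α → β) (k : ℕ) (D₂ : Finset α) (a : α) (ha : a ∉ D₂)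
    (D₁ : Finset α) (hD₁ : D₁ = insert a D₂)
    (c : ℕ) (hc : c = D₁.card) (hk : k ≤ c - 1) (S : Set β) :
    |mechProb L k D₁ S - mechProb L k D₂ S| ≤ (k : ℝ) / c := by
  have hsub : D₂ ⊆ D₁ := hD₁ ▸ Finset.subset_insert a D₂
  have hcard : D₁.card = D₂.card + 1 := by rw [hD₁, Finset.card_insert_of_notMem ha]
  have hk₂ : k ≤ D₂.card := by omega
  have hm : 0 < D₂.card.choose k := Nat.choose_pos hk₂
  have hmn : D₂.card.choose k ≤ D₁.card.choose k :=
    Nat.choose_le_choose k (Finset.card_le_card hsub)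
  have hn : 0 < D₁.card.choose k := hm.trans_le hmn
  have hratio : (k : ℝ) / c = 1 - (D₂.card.choose k : ℝ) / D₁.card.choose k := by
    have hmul := Nat.choose_mul_succ_eq D₂.card k
    rw [← hcard, ← hc] at hmul
    have hcast : (D₂.card.choose k : ℝ) * c = (c.choose k : ℝ) * (c - k) := by
      rw [← Nat.cast_sub (by omega : k ≤ c)]
      exact_mod_cast hmul
    rw [← hc] at hn ⊢
    have hn' : (c.choose k : ℝ) ≠ 0 := by exact_mod_cast hn.ne'
    have hc' : (c : ℝ) ≠ 0 := by
      have : c ≠ 0 := by omega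
      exact_mod_cast this
    field_simp
    linarith
  rw [hratio]
  refine abs_div_sub_div_le (by exact_mod_cast hm) (by exact_mod_cast hn) (by exact_mod_cast hmn)
    (Nat.cast_nonneg _) ?_ ?_ ?_
  · exact_mod_cast card_filter_le_choose L k D₂ S
  · exact_mod_cast Finset.card_le_card
      (Finset.filter_subset_filter _ (Finset.powerset_mono.2 hsub))
  · exact_mod_cast card_add_choose_le_card_add_choose L k hsub S
end
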